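/- arXiv:1602.05173 — 4 statements merged into one kernel-verified Lean document; each statement's English description precedes it below -/
import Mathlib

section
/- Let L be a first-order language, κ > |L| an uncountable cardinal, and M an L-structure that is κ-saturated and strongly κ-homogeneous. Then the following are equivalent: (1) M is unimodular; (2) (correspondence unimodularity for complete types) for every A ⊆ M with |A| < κ, all complete types p, q over A, and any two uniform correspondences C₁, C₂ over A between p(M) and q(M), one has m_{C₁} = m_{C₂}; (3) (functional unimodularity for complete types) for every A ⊆ M with |A| < κ, all complete types p, q over A, and any two functions f, g : p(M) → q(M) that are relatively definable over A and such that every fibre f⁻¹(y) has exactly k elements and every fibre g⁻¹(y) has exactly ℓ elements (for all y ∈ q(M)), one has k = ℓ. -/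
open FirstOrder Set

namespace Unimod

universe u v w

variable (L : FirstOrder.Language.{u, v}) {M : Type w} [L.Structure M]

/-- Two tuples (indexed by `α`) satisfy the same `L`-formulas with parameters from `A`,
i.e. they have the same complete type over `A`. -/
def SameType (A : Set M) {α : Type*} (a b : α → M) : Prop :=
  ∀ φ : L.Formula (↥A ⊕ α),
    φ.Realize (Sum.elim (fun x => (x : M)) a) ↔ φ.Realize (Sum.elim (fun x => (x : M)) b)

/-- The set of realizations of the complete type of the tuple `a` over `A`. -/
def typeSet (A : Set M) {α : Type*} (a : α → M) : Set (α → M) :=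
  {b | SameType L A a b}

/-- A set is type-definable over `A` if it is an intersection of a family of `A`-definable
sets. -/
def TypeDefinable (A : Set M) {α : Type*} (s : Set (α → M)) : Prop :=
  ∃ S : Set (Set (α → M)), (∀ t ∈ S, A.Definable L t) ∧ s = ⋂₀ S

/-- View a set of pairs of tuples as a set of `Fin n ⊕ Fin m`-indexed tuples. -/
def pairSet {M : Type w} {n m : ℕ} (C : Set ((Fin n → M) × (Fin m → M))) :
    Set ((Fin n ⊕ Fin m) → M) :=
  {v | (v ∘ Sum.inl, v ∘ Sum.inr) ∈ C}

/-- A correspondence over `A` between `X ⊆ M^n` and `Y ⊆ M^m`: a nonempty subset of `X × Y`,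
type-definable over `A`, all of whose fibres and cofibres are finite. -/
structure IsCorrespondence (A : Set M) {n m : ℕ} (X : Set (Fin n → M)) (Y : Set (Fin m → M))
    (C : Set ((Fin n → M) × (Fin m → M))) : Prop where
  nonempty : C.Nonempty
  subset : C ⊆ X ×ˢ Y
  typeDefinable : TypeDefinable L A (pairSet C)
  finite_fibers : ∀ x ∈ X, {y | (x, y) ∈ C}.Finite
  finite_cofibers : ∀ y ∈ Y, {x | (x, y) ∈ C}.Finite

/-- A uniform correspondence over `A` with constant fibre size `k` and cofibre size `ℓ`. -/
structure IsUniformCorrespondence (A : Set M) {n m : ℕ} (X : Set (Fin n → M))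
    (Y : Set (Fin m → M)) (C : Set ((Fin n → M) × (Fin m → M))) (k ℓ : ℕ)
    extends IsCorrespondence L A X Y C : Prop where
  k_pos : 0 < k
  l_pos : 0 < ℓ
  fiber_card : ∀ x ∈ X, {y | (x, y) ∈ C}.ncard = k
  cofiber_card : ∀ y ∈ Y, {x | (x, y) ∈ C}.ncard = ℓ

/-- A type-definable set `X` is measurable over `A` if every uniform correspondence over `A`
between `X` and itself is balanced. -/
def MeasurableOver (A : Set M) {n : ℕ} (X : Set (Fin n → M)) : Prop :=
  ∀ (C : Set ((Fin n → M) × (Fin n → M))) (k ℓ : ℕ),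
    IsUniformCorrespondence L A X X C k ℓ → k = ℓ

/-- `X` and `Y` are commensurable over `A`, with common ratio `r`. -/
def CommensurableOverWithRatio (A : Set M) {n m : ℕ} (X : Set (Fin n → M))
    (Y : Set (Fin m → M)) (r : ℚ) : Prop :=
  (∃ C k ℓ, IsUniformCorrespondence L A X Y C k ℓ) ∧
    ∀ C k ℓ, IsUniformCorrespondence L A X Y C k ℓ → (k : ℚ) / (ℓ : ℚ) = r

/-- `X` and `Y` are commensurable over `A`: there is a uniform correspondence over `A` between
them, and all such have the same ratio. -/
def CommensurableOver (A : Set M) {n m : ℕ} (X : Set (Fin n → M)) (Y : Set (Fin m → M)) : Prop :=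
  ∃ r : ℚ, CommensurableOverWithRatio L A X Y r

/-- `M` is strongly homogeneous over `A`: any two tuples with the same type over `A` are
conjugate by an automorphism of `M` fixing `A` pointwise. -/
def StronglyHomogeneousOver (A : Set M) : Prop :=
  ∀ (n : ℕ) (a b : Fin n → M), SameType L A a b →
    ∃ σ : M ≃[L] M, (∀ x ∈ A, σ x = x) ∧ ∀ i, σ (a i) = b i

/-- `M` is unimodular (with respect to the cardinal bound `κ` on parameter sets):
whenever `a ≡_A b` are interalgebraic over `A`, then `m(a/A ∪ b) = m(b/A ∪ a)`. -/
def Unimodular (κ : Cardinal.{w}) : Prop :=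
  ∀ A : Set M, Cardinal.mk A < κ → ∀ (n : ℕ) (a b : Fin n → M),
    SameType L A a b →
    (typeSet L (A ∪ Set.range b) a).Finite →
    (typeSet L (A ∪ Set.range a) b).Finite →
    (typeSet L (A ∪ Set.range b) a).ncard = (typeSet L (A ∪ Set.range a) b).ncard

/-- `M` is `κ`-saturated: every finitely satisfiable set of formulas in finitely many free
variables with parameters from a set of size `< κ` is realized in `M`. -/
def Saturated (κ : Cardinal.{w}) : Prop :=
  ∀ A : Set M, Cardinal.mk A < κ →
    ∀ (n : ℕ) (T : Set (L.Formula (↥A ⊕ Fin n))),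
      (∀ T₀ : Finset (L.Formula (↥A ⊕ Fin n)), ↑T₀ ⊆ T →
        ∃ v : Fin n → M, ∀ φ ∈ T₀, φ.Realize (Sum.elim (fun x => (x : M)) v)) →
      ∃ v : Fin n → M, ∀ φ ∈ T, φ.Realize (Sum.elim (fun x => (x : M)) v)

/-- A function `f : X → Y` is relatively definable over `A` if its graph is the intersection
of an `A`-definable set with `X × Y`. -/
def RelativelyDefinableFn (A : Set M) {n m : ℕ} (X : Set (Fin n → M)) (Y : Set (Fin m → M))
    (f : (Fin n → M) → (Fin m → M)) : Prop :=
  ∃ D : Set ((Fin n ⊕ Fin m) → M), A.Definable L D ∧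
    ∀ x ∈ X, ∀ y ∈ Y, (Sum.elim x y ∈ D ↔ f x = y)

/-- The `≡_A`-class of the pair `c`. -/
def pairClass (A : Set M) {n m : ℕ} (c : (Fin n → M) × (Fin m → M)) :
    Set ((Fin n → M) × (Fin m → M)) :=
  {p | SameType L A (Sum.elim c.1 c.2) (Sum.elim p.1 p.2)}

/-- A complete correspondence over `A`: a correspondence which is a single `≡_A`-class. -/
def IsCompleteCorrespondence (A : Set M) {n m : ℕ} (X : Set (Fin n → M)) (Y : Set (Fin m → M))
    (C : Set ((Fin n → M) × (Fin m → M))) : Prop :=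
  IsCorrespondence L A X Y C ∧ ∃ c ∈ C, C = pairClass L A c


section GroupAction

open MulAction

variable {G : Type*} [Group G]

/-- If `H` is commensurable with `K` and `K'`, and `K`, `K'` have the same index in each other,
then the index ratios of `(H, K)` and `(H, K')` agree. -/
theorem relIndex_mul_relIndex_eq_of_relIndex_eq {H K K' : Subgroup G}
    (hHK : H.relIndex K ≠ 0) (hKH : K.relIndex H ≠ 0)
    (hHK' : H.relIndex K' ≠ 0) (hKH' : K'.relIndex H ≠ 0)
    (hunim : K.relIndex K' ≠ 0 → K'.relIndex K ≠ 0 →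
      K.relIndex K' = K'.relIndex K) :
    K'.relIndex H * H.relIndex K = H.relIndex K' * K.relIndex H := by
  have hw : K.relIndex K' = K'.relIndex K :=
    hunim (Subgroup.relIndex_ne_zero_trans hKH hHK')
      (Subgroup.relIndex_ne_zero_trans hKH' hHK)
  let I := H ⊓ K ⊓ K'
  have hI₁ : I ≤ H ⊓ K := inf_le_left
  have hI₂ : I ≤ H ⊓ K' := inf_le_inf_right K' inf_le_left
  have hI₃ : I ≤ K ⊓ K' := inf_le_inf_right K' inf_le_right
  have hx : I.relIndex (H ⊓ K) ≠ 0 := by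
    rw [Subgroup.inf_relIndex_left]
    exact fun h => hKH' (Subgroup.relIndex_eq_zero_of_le_right inf_le_left h)
  have hy : I.relIndex (H ⊓ K') ≠ 0 := by
    rw [show I = K ⊓ (H ⊓ K') by rw [← inf_assoc, inf_comm K H], Subgroup.inf_relIndex_right]
    exact fun h => hKH (Subgroup.relIndex_eq_zero_of_le_right inf_le_left h)
  have e₁ := Subgroup.relIndex_mul_relIndex I _ _ hI₁ inf_le_left
  have e₂ := Subgroup.relIndex_mul_relIndex I _ _ hI₁ inf_le_right
  have e₃ := Subgroup.relIndex_mul_relIndex I _ _ hI₂ inf_le_left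
  have e₄ := Subgroup.relIndex_mul_relIndex I _ _ hI₂ inf_le_right
  have e₅ := Subgroup.relIndex_mul_relIndex I _ _ hI₃ inf_le_left
  have e₆ := Subgroup.relIndex_mul_relIndex I _ _ hI₃ inf_le_right
  rw [Subgroup.inf_relIndex_left H K] at e₁
  rw [Subgroup.inf_relIndex_left H K'] at e₃
  rw [Subgroup.inf_relIndex_left K K'] at e₅
  rw [Subgroup.inf_relIndex_right] at e₂ e₄ e₆
  rw [← hw] at e₅
  refine Nat.eq_of_mul_eq_mul_left (Nat.pos_of_ne_zero (mul_ne_zero hx hy)) ?_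
  calc I.relIndex (H ⊓ K) * I.relIndex (H ⊓ K') * (K'.relIndex H * H.relIndex K)
      = (I.relIndex (H ⊓ K') * K'.relIndex H) * (I.relIndex (H ⊓ K) * H.relIndex K) := by ring
    _ = (I.relIndex (H ⊓ K) * K.relIndex H) * (I.relIndex (H ⊓ K') * H.relIndex K') := by
        rw [e₁, e₂, e₃, e₄, ← e₅, ← e₆]
    _ = I.relIndex (H ⊓ K) * I.relIndex (H ⊓ K') * (H.relIndex K' * K.relIndex H) := by ring

/-- Counting an invariant relation along its orbits: if on each orbit the fibre and cofibre sizes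
have ratio `r / s`, then so do the fibre over `x` and the cofibre over `y`. -/
theorem ncard_fiber_mul_eq {X Y : Type*} [MulAction G X] [MulAction G Y] {C : Set (X × Y)}
    (hC : ∀ (g : G) (p : X × Y), p ∈ C → g • p ∈ C) {x : X} {y : Y} {r s : ℕ}
    (hx : {y' | (x, y') ∈ C}.Finite) (hy : {x' | (x', y) ∈ C}.Finite)
    (hXorb : ∀ x', (x', y) ∈ C → x' ∈ orbit G x)
    (hYorb : ∀ y', (x, y') ∈ C → y ∈ orbit G y')
    (hr : ∀ y', (x, y') ∈ C →
      (orbit (stabilizer G x) y').ncard * s = (orbit (stabilizer G y') x).ncard * r) :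
    {y' | (x, y') ∈ C}.ncard * s = {x' | (x', y) ∈ C}.ncard * r := by
  classical
  let φ : X × Y → orbitRel.Quotient G (X × Y) := Quotient.mk _
  have hφ : ∀ p q : X × Y, φ p = φ q ↔ ∃ g : G, g • q = p := fun p q =>
    Quotient.eq.trans orbitRel_apply
  rw [Set.ncard_eq_toFinset_card _ hx, Set.ncard_eq_toFinset_card _ hy,
    Finset.card_eq_sum_card_fiberwise (f := fun y' => φ (x, y'))
      (t := hx.toFinset.image fun y' => φ (x, y'))
      (fun y' h => Finset.mem_coe.2 (Finset.mem_image_of_mem _ h)),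
    Finset.card_eq_sum_card_fiberwise (f := fun x' => φ (x', y))
      (t := hx.toFinset.image fun y' => φ (x, y')), Finset.sum_mul, Finset.sum_mul]
  · refine Finset.sum_congr rfl fun ω hω => ?_
    obtain ⟨y', hy', rfl⟩ := Finset.mem_image.1 hω
    have hxy' : (x, y') ∈ C := by simpa using hy'
    have h1 : ({a ∈ hx.toFinset | φ (x, a) = φ (x, y')} : Finset Y).card
        = (orbit (stabilizer G x) y').ncard := by
      rw [← Set.ncard_coe_finset]
      congr 1
      ext b
      simp only [Finset.coe_filter, Set.Finite.mem_toFinset, Set.mem_ofPred_eq, hφ]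
      constructor
      · rintro ⟨-, g, hg⟩
        rw [Prod.smul_mk, Prod.mk.injEq] at hg
        exact ⟨⟨g, hg.1⟩, hg.2⟩
      · rintro ⟨⟨g, hg⟩, rfl⟩
        have h : g • (x, y') = (x, g • y') := Prod.ext hg rfl
        exact ⟨h ▸ hC g _ hxy', g, h⟩
    have h2 : ({a ∈ hy.toFinset | φ (a, y) = φ (x, y')} : Finset X).card
        = (orbit (stabilizer G y') x).ncard := by
      obtain ⟨g, hg⟩ := hYorb y' hxy'
      replace hg : g • y' = y := hg
      rw [← Set.ncard_coe_finset,
        ← Set.ncard_image_of_injective (orbit (stabilizer G y') x) (MulAction.injective g)]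
      congr 1
      ext b
      simp only [Finset.coe_filter, Set.Finite.mem_toFinset, Set.mem_ofPred_eq, hφ]
      constructor
      · rintro ⟨-, h, hh⟩
        rw [Prod.smul_mk, Prod.mk.injEq] at hh
        refine ⟨(g⁻¹ * h) • x, ⟨⟨g⁻¹ * h, ?_⟩, rfl⟩, ?_⟩
        · rw [mem_stabilizer_iff, mul_smul, hh.2, ← hg, inv_smul_smul]
        · simp [mul_smul, hh.1]
      · rintro ⟨_, ⟨⟨h, hh⟩, rfl⟩, rfl⟩
        have e : (g * h) • (x, y') = (g • h • x, y) := by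
          rw [Prod.smul_mk, mul_smul, mul_smul, mem_stabilizer_iff.1 hh, hg]
        exact ⟨e ▸ hC (g * h) _ hxy', g * h, e⟩
    rw [h1, h2, hr y' hxy']
  · intro x' hx'
    have hx'C : (x', y) ∈ C := by simpa using hx'
    obtain ⟨g, rfl⟩ := hXorb x' hx'C
    have h : (x, g⁻¹ • y) ∈ C := by simpa using hC g⁻¹ _ hx'C
    refine Finset.mem_coe.2 (Finset.mem_image.2 ⟨g⁻¹ • y, by simpa using h, ?_⟩)
    exact (hφ _ _).2 ⟨g⁻¹, by simp⟩

theorem ncard_orbit_stabilizer {X Y : Type*} [MulAction G X] [MulAction G Y] (x : X) (y : Y) :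
    (orbit (stabilizer G x) y).ncard = (stabilizer G y).relIndex (stabilizer G x) := by
  rw [← index_stabilizer]
  rfl

end GroupAction

section Automorphisms

open MulAction

/-- The group of permutations of `M` underlying the automorphisms which fix `A` pointwise. -/
def autFixing (A : Set M) : Subgroup (Equiv.Perm M) where
  carrier := {σ | (∃ τ : M ≃[L] M, τ.toEquiv = σ) ∧ ∀ x ∈ A, σ x = x}
  one_mem' := ⟨⟨Language.Equiv.refl L M, rfl⟩, fun _ _ => rfl⟩
  mul_mem' := by
    rintro _ _ ⟨⟨σ, rfl⟩, hσ⟩ ⟨⟨τ, rfl⟩, hτ⟩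
    refine ⟨⟨σ.comp τ, rfl⟩, fun x hx => ?_⟩
    rw [Equiv.Perm.mul_apply, hτ x hx, hσ x hx]
  inv_mem' := by
    rintro _ ⟨⟨σ, rfl⟩, hσ⟩
    exact ⟨⟨σ.symm, rfl⟩, fun x hx => (Equiv.symm_apply_eq _).2 (hσ x hx).symm⟩

variable {L}
variable {A : Set M}

theorem sameType_smul {α : Type*} (σ : autFixing L A) (x : α → M) : SameType L A x (σ • x) := by
  obtain ⟨_, ⟨τ, rfl⟩, hτ⟩ := σ
  intro φ
  rw [← Language.StrongHomClass.realize_formula τ φ]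
  refine iff_of_eq (congrArg φ.Realize ?_)
  ext (i | i)
  · exact hτ _ i.2
  · rfl

theorem SameType.mem_of_definable {α : Type*} {x y : α → M} (h : SameType L A x y)
    {D : Set (α → M)} (hD : A.Definable L D) (hx : x ∈ D) : y ∈ D := by
  obtain ⟨φ, rfl⟩ := Set.definable_iff_exists_formula_sum.1 hD
  exact (h φ).1 hx

theorem SameType.mem_of_typeDefinable {α : Type*} {x y : α → M} (h : SameType L A x y)
    {S : Set (α → M)} (hS : TypeDefinable L A S) (hx : x ∈ S) : y ∈ S := by
  obtain ⟨T, hT, rfl⟩ := hS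
  exact fun t ht => h.mem_of_definable (hT t ht) (hx t ht)

theorem typeSet_eq_orbit (hA : StronglyHomogeneousOver L A) {n : ℕ} (a : Fin n → M) :
    typeSet L A a = orbit (autFixing L A) a := by
  ext y
  constructor
  · intro h
    obtain ⟨σ, hσ, hσa⟩ := hA n a y h
    exact ⟨⟨σ.toEquiv, ⟨σ, rfl⟩, hσ⟩, funext hσa⟩
  · rintro ⟨σ, rfl⟩
    exact sameType_smul σ a

theorem typeSet_union_range_eq_orbit {n m : ℕ} {a : Fin n → M} {b : Fin m → M}
    (hA : StronglyHomogeneousOver L (A ∪ Set.range b)) :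
    typeSet L (A ∪ Set.range b) a = orbit (stabilizer (autFixing L A) b) a := by
  rw [typeSet_eq_orbit hA]
  ext y
  constructor
  · rintro ⟨⟨σ, hσ, hσA⟩, rfl⟩
    exact ⟨⟨⟨σ, hσ, fun x hx => hσA x (Or.inl hx)⟩,
      funext fun i => hσA _ (Or.inr ⟨i, rfl⟩)⟩, rfl⟩
  · rintro ⟨⟨⟨σ, hσ, hσA⟩, hσb⟩, rfl⟩
    refine ⟨⟨σ, hσ, ?_⟩, rfl⟩
    rintro x (hx | ⟨i, rfl⟩)
    · exact hσA x hx
    · exact congrFun hσb i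

theorem stabilizer_append {n m : ℕ} (a : Fin n → M) (b : Fin m → M) :
    stabilizer (autFixing L A) (Fin.append a b) =
      stabilizer (autFixing L A) a ⊓ stabilizer (autFixing L A) b := by
  ext σ
  simp only [Subgroup.mem_inf, mem_stabilizer_iff]
  constructor
  · intro h
    constructor
    · ext i
      simpa using congrFun h (Fin.castAdd m i)
    · ext i
      simpa using congrFun h (Fin.natAdd n i)
  · rintro ⟨h1, h2⟩
    ext i
    refine Fin.addCases (fun i => ?_) (fun i => ?_) i
    · simpa using congrFun h1 i
    · simpa using congrFun h2 i

theorem relativelyDefinableFn_comp {n m : ℕ} (X : Set (Fin n → M)) (Y : Set (Fin m → M))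
    (e : Fin m → Fin n) : RelativelyDefinableFn L A X Y fun x => x ∘ e := by
  refine ⟨⋂ i, {v | v (Sum.inl (e i)) = v (Sum.inr i)}, ?_, fun x _ y _ => ?_⟩
  · refine Set.definable_iInter_of_finite fun i => ?_
    refine Set.definable_iff_exists_formula_sum.2
      ⟨(Language.Term.var (Sum.inr (Sum.inl (e i)))).equal
        (Language.Term.var (Sum.inr (Sum.inr i))), ?_⟩
    ext v
    simp
  · simp [funext_iff]

/-- The fibres of a reindexing map on an orbit all have the same cardinality, an index of
stabilizers. -/
theorem ncard_orbit_comp_fiber {α β : Type*} (c : β → M) (e : α → β) {y : α → M}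
    (hy : y ∈ orbit (autFixing L A) (c ∘ e)) :
    {x ∈ orbit (autFixing L A) c | x ∘ e = y}.ncard =
      (stabilizer (autFixing L A) c).relIndex (stabilizer (autFixing L A) (c ∘ e)) := by
  obtain ⟨σ, rfl⟩ := hy
  rw [← ncard_orbit_stabilizer, ← Set.ncard_image_of_injective
    (orbit (stabilizer (autFixing L A) (c ∘ e)) c) (MulAction.injective σ)]
  congr 1
  ext x
  constructor
  · rintro ⟨⟨τ, rfl⟩, hτ⟩
    refine ⟨(σ⁻¹ * τ) • c, ⟨⟨σ⁻¹ * τ, ?_⟩, rfl⟩, ?_⟩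
    · replace hτ : τ • (c ∘ e) = σ • (c ∘ e) := hτ
      rw [mem_stabilizer_iff, mul_smul, hτ, inv_smul_smul]
    · simp [mul_smul]
  · rintro ⟨_, ⟨⟨τ, hτ⟩, rfl⟩, rfl⟩
    refine ⟨⟨σ * τ, mul_smul _ _ _⟩, ?_⟩
    exact congrArg (σ • ·) (mem_stabilizer_iff.1 hτ)

theorem typeDefinable_typeSet_comp {α β : Type*} (a : α → M) (e : α → β) :
    TypeDefinable L A {v : β → M | v ∘ e ∈ typeSet L A a} := by
  refine ⟨{t | A.Definable L t ∧ ∀ v, v ∘ e ∈ typeSet L A a → v ∈ t}, fun t ht => ht.1, ?_⟩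
  refine Set.Subset.antisymm (fun v hv t ht => ht.2 v hv) fun v hv φ => ?_
  have key : ∀ ψ : L.Formula (↥A ⊕ α), ψ.Realize (Sum.elim (fun x => (x : M)) a) →
      ψ.Realize (Sum.elim (fun x => (x : M)) (v ∘ e)) := by
    intro ψ hψ
    have := hv {w : β → M | ψ.Realize (Sum.elim (fun x => (x : M)) (w ∘ e))}
      ⟨(Set.definable_iff_exists_formula_sum.2 ⟨ψ, rfl⟩ :
        A.Definable L {u : α → M | ψ.Realize (Sum.elim (fun x => (x : M)) u)}).preimage_comp e,
        fun w hw => (hw ψ).1 hψ⟩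
    exact this
  refine ⟨key φ, fun h => ?_⟩
  by_contra hn
  exact (key φ.not (Language.Formula.realize_not.2 hn)) h

theorem TypeDefinable.inter {α : Type*} {s t : Set (α → M)} (hs : TypeDefinable L A s)
    (ht : TypeDefinable L A t) : TypeDefinable L A (s ∩ t) := by
  obtain ⟨S, hS, rfl⟩ := hs
  obtain ⟨T, hT, rfl⟩ := ht
  exact ⟨S ∪ T, fun u hu => hu.elim (hS u) (hT u), Set.sInter_union S T |>.symm⟩

theorem TypeDefinable.of_definable {α : Type*} {s : Set (α → M)} (hs : A.Definable L s) :
    TypeDefinable L A s :=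
  ⟨{s}, by simpa using hs, by simp⟩

theorem isUniformCorrespondence_graph {n m : ℕ} {a : Fin n → M} {b : Fin m → M}
    {f : (Fin n → M) → (Fin m → M)} {k : ℕ}
    (hmaps : Set.MapsTo f (typeSet L A a) (typeSet L A b))
    (hdef : RelativelyDefinableFn L A (typeSet L A a) (typeSet L A b) f)
    (hcard : ∀ y ∈ typeSet L A b, ({x ∈ typeSet L A a | f x = y}).Finite ∧
      ({x ∈ typeSet L A a | f x = y}).ncard = k) :
    IsUniformCorrespondence L A (typeSet L A a) (typeSet L A b)
      {p | p.1 ∈ typeSet L A a ∧ f p.1 = p.2} 1 k := by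
  have ha : a ∈ typeSet L A a := fun _ => Iff.rfl
  have hfib : ∀ x ∈ typeSet L A a,
      {y | (x, y) ∈ {p : (Fin n → M) × (Fin m → M) | p.1 ∈ typeSet L A a ∧ f p.1 = p.2}}
        = {f x} := by
    intro x hx
    ext y
    simp [hx, eq_comm]
  refine
    { nonempty := ⟨(a, f a), ha, rfl⟩
      subset := ?_
      typeDefinable := ?_
      finite_fibers := fun x hx => by rw [hfib x hx]; exact Set.finite_singleton _
      finite_cofibers := fun y hy => (hcard y hy).1
      k_pos := one_pos
      l_pos := ?_
      fiber_card := fun x hx => by rw [hfib x hx, Set.ncard_singleton]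
      cofiber_card := fun y hy => (hcard y hy).2 }
  · rintro ⟨x, y⟩ ⟨hx, hy⟩
    exact ⟨hx, hy ▸ hmaps hx⟩
  · obtain ⟨D, hD, hDf⟩ := hdef
    have h := ((typeDefinable_typeSet_comp a (Sum.inl : Fin n → Fin n ⊕ Fin m)).inter
      (typeDefinable_typeSet_comp b (Sum.inr : Fin m → Fin n ⊕ Fin m))).inter
      (TypeDefinable.of_definable hD)
    convert h using 1
    ext v
    have hv := hDf (v ∘ Sum.inl)
    constructor
    · rintro ⟨h1, h2⟩
      replace h2 : f (v ∘ Sum.inl) = v ∘ Sum.inr := h2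
      have h3 : v ∘ Sum.inr ∈ typeSet L A b := h2 ▸ hmaps h1
      refine ⟨⟨h1, h3⟩, ?_⟩
      simpa using (hv h1 _ h3).2 h2
    · rintro ⟨⟨h1, h3⟩, h4⟩
      exact ⟨h1, (hv h1 _ h3).1 (by simpa using h4)⟩
  · obtain ⟨hfin, rfl⟩ := hcard _ (hmaps ha)
    exact (Set.ncard_pos hfin).2 ⟨a, ha, rfl⟩

theorem IsCorrespondence.smul_mem {n m : ℕ} {X : Set (Fin n → M)} {Y : Set (Fin m → M)}
    {C : Set ((Fin n → M) × (Fin m → M))} (hC : IsCorrespondence L A X Y C) (σ : autFixing L A)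
    (p : (Fin n → M) × (Fin m → M)) (hp : p ∈ C) : σ • p ∈ C :=
  (sameType_smul σ (Sum.elim p.1 p.2)).mem_of_typeDefinable hC.typeDefinable
    (show Sum.elim p.1 p.2 ∈ pairSet C from hp)

end Automorphisms

section Equivalences

open MulAction

variable {L}
variable {κ : Cardinal.{w}}

theorem mk_union_range_lt (hκ : Cardinal.aleph0 < κ) {A : Set M} (hA : Cardinal.mk A < κ)
    {n : ℕ} (b : Fin n → M) : Cardinal.mk (A ∪ Set.range b : Set M) < κ :=
  (Cardinal.mk_union_le _ _).trans_lt (Cardinal.add_lt_of_lt hκ.le hA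
    ((Set.finite_range b).lt_aleph0.trans hκ))

theorem ncard_typeSet_union_range (hκ : Cardinal.aleph0 < κ)
    (hhom : ∀ A : Set M, Cardinal.mk A < κ → StronglyHomogeneousOver L A)
    {A : Set M} (hA : Cardinal.mk A < κ) {n m : ℕ} (a : Fin n → M) (b : Fin m → M) :
    (typeSet L (A ∪ Set.range b) a).ncard =
      (stabilizer (autFixing L A) a).relIndex (stabilizer (autFixing L A) b) := by
  rw [typeSet_union_range_eq_orbit (hhom _ (mk_union_range_lt hκ hA b)), ncard_orbit_stabilizer]

theorem finite_typeSet_iff {B : Set M} {n : ℕ} (a : Fin n → M) :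
    (typeSet L B a).Finite ↔ (typeSet L B a).ncard ≠ 0 :=
  ⟨fun h => ((Set.ncard_pos h).2 ⟨a, fun _ => Iff.rfl⟩).ne', Set.finite_of_ncard_ne_zero⟩

/-- Unimodularity says that conjugate commensurable stabilizers have equal index in each other. -/
theorem unimodular_iff_relIndex (hκ : Cardinal.aleph0 < κ)
    (hhom : ∀ A : Set M, Cardinal.mk A < κ → StronglyHomogeneousOver L A) :
    Unimodular L (M := M) κ ↔ ∀ A : Set M, Cardinal.mk A < κ → ∀ (n : ℕ) (a b : Fin n → M),
      b ∈ typeSet L A a →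
      (stabilizer (autFixing L A) a).relIndex (stabilizer (autFixing L A) b) ≠ 0 →
      (stabilizer (autFixing L A) b).relIndex (stabilizer (autFixing L A) a) ≠ 0 →
      (stabilizer (autFixing L A) a).relIndex (stabilizer (autFixing L A) b) =
        (stabilizer (autFixing L A) b).relIndex (stabilizer (autFixing L A) a) := by
  refine forall₅_congr fun A hA n a b => ?_
  rw [finite_typeSet_iff, finite_typeSet_iff, ncard_typeSet_union_range hκ hhom hA,
    ncard_typeSet_union_range hκ hhom hA]
  rfl

theorem Unimodular.ratio_eq (hκ : Cardinal.aleph0 < κ)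
    (hhom : ∀ A : Set M, Cardinal.mk A < κ → StronglyHomogeneousOver L A)
    (hM : Unimodular L (M := M) κ) {A : Set M} (hA : Cardinal.mk A < κ) {n m : ℕ}
    {a : Fin n → M} {b : Fin m → M} {C₁ C₂ : Set ((Fin n → M) × (Fin m → M))}
    {k₁ ℓ₁ k₂ ℓ₂ : ℕ}
    (h₁ : IsUniformCorrespondence L A (typeSet L A a) (typeSet L A b) C₁ k₁ ℓ₁)
    (h₂ : IsUniformCorrespondence L A (typeSet L A a) (typeSet L A b) C₂ k₂ ℓ₂) :
    (k₁ : ℚ) / (ℓ₁ : ℚ) = (k₂ : ℚ) / (ℓ₂ : ℚ) := by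
  rw [unimodular_iff_relIndex hκ hhom] at hM
  have ha : a ∈ typeSet L A a := fun _ => Iff.rfl
  have hb : b ∈ typeSet L A b := fun _ => Iff.rfl
  have hYorb : ∀ {C k ℓ}, IsUniformCorrespondence L A (typeSet L A a) (typeSet L A b) C k ℓ →
      ∀ y, (a, y) ∈ C → y ∈ orbit (autFixing L A) b := fun h y hy =>
    typeSet_eq_orbit (hhom A hA) b ▸ (h.subset hy).2
  have hXorb : ∀ {C k ℓ}, IsUniformCorrespondence L A (typeSet L A a) (typeSet L A b) C k ℓ →
      ∀ x y, (x, y) ∈ C → x ∈ orbit (autFixing L A) a := fun h x y hy =>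
    typeSet_eq_orbit (hhom A hA) a ▸ (h.subset hy).1
  have hfin : ∀ {C k ℓ}, IsUniformCorrespondence L A (typeSet L A a) (typeSet L A b) C k ℓ →
      ∀ y, (a, y) ∈ C →
      (stabilizer (autFixing L A) y).relIndex (stabilizer (autFixing L A) a) ≠ 0 ∧
      (stabilizer (autFixing L A) a).relIndex (stabilizer (autFixing L A) y) ≠ 0 := by
    intro C k ℓ h y hy
    rw [← ncard_orbit_stabilizer, ← ncard_orbit_stabilizer]
    constructor
    · refine (Set.ncard_pos ((h.finite_fibers a ha).subset ?_)).2 ⟨y, mem_orbit_self y⟩ |>.ne'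
      rintro _ ⟨⟨σ, hσ⟩, rfl⟩
      have e : σ • (a, y) = (a, σ • y) := Prod.ext hσ rfl
      have hσy := h.smul_mem σ _ hy
      rw [e] at hσy
      exact hσy
    · refine (Set.ncard_pos ((h.finite_cofibers y (h.subset hy).2).subset ?_)).2
        ⟨a, mem_orbit_self a⟩ |>.ne'
      rintro _ ⟨⟨σ, hσ⟩, rfl⟩
      have e : σ • (a, y) = (σ • a, y) := Prod.ext rfl hσ
      have hσy := h.smul_mem σ _ hy
      rw [e] at hσy
      exact hσy
  obtain ⟨c, hc⟩ : {y | (a, y) ∈ C₁}.Nonempty :=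
    Set.nonempty_of_ncard_ne_zero ((h₁.fiber_card a ha).trans_ne h₁.k_pos.ne')
  replace hc : (a, c) ∈ C₁ := hc
  obtain ⟨hk0, hl0⟩ := hfin h₁ c hc
  have key : ∀ {C k ℓ}, IsUniformCorrespondence L A (typeSet L A a) (typeSet L A b) C k ℓ →
      k * (stabilizer (autFixing L A) a).relIndex (stabilizer (autFixing L A) c) =
        ℓ * (stabilizer (autFixing L A) c).relIndex (stabilizer (autFixing L A) a) := by
    intro C k ℓ h
    have hcb : c ∈ typeSet L A b := (h₁.subset hc).2
    rw [← h.fiber_card a ha, ← h.cofiber_card c hcb]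
    have hcorb : ∀ y, (a, y) ∈ C → c ∈ orbit (autFixing L A) y := fun y hy => by
      rw [orbit_eq_iff.2 (hYorb h y hy)]
      exact hYorb h₁ c hc
    refine ncard_fiber_mul_eq h.smul_mem (h.finite_fibers a ha) (h.finite_cofibers c hcb)
      (fun x hx => hXorb h x c hx) hcorb fun y hy => ?_
    rw [ncard_orbit_stabilizer, ncard_orbit_stabilizer]
    obtain ⟨hk, hl⟩ := hfin h y hy
    refine relIndex_mul_relIndex_eq_of_relIndex_eq hl0 hk0 hl hk fun h1 h2 => ?_
    refine (hM A hA m y c ?_ h2 h1).symm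
    rw [typeSet_eq_orbit (hhom A hA)]
    exact hcorb y hy
  have e₁ := key h₁
  have e₂ := key h₂
  have hℓ₁ := h₁.l_pos
  have hℓ₂ := h₂.l_pos
  rw [div_eq_div_iff (by positivity) (by positivity)]
  norm_cast
  refine Nat.eq_of_mul_eq_mul_right (Nat.pos_of_ne_zero hl0) ?_
  linear_combination ℓ₂ * e₁ - ℓ₁ * e₂

theorem unimodular_of_functional (hκ : Cardinal.aleph0 < κ)
    (hhom : ∀ A : Set M, Cardinal.mk A < κ → StronglyHomogeneousOver L A)
    (hfun : ∀ A : Set M, Cardinal.mk A < κ → ∀ (n m : ℕ) (a : Fin n → M) (b : Fin m → M)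
        (f g : (Fin n → M) → (Fin m → M)) (k ℓ : ℕ),
        Set.MapsTo f (typeSet L A a) (typeSet L A b) →
        Set.MapsTo g (typeSet L A a) (typeSet L A b) →
        RelativelyDefinableFn L A (typeSet L A a) (typeSet L A b) f →
        RelativelyDefinableFn L A (typeSet L A a) (typeSet L A b) g →
        (∀ y ∈ typeSet L A b, ({x ∈ typeSet L A a | f x = y}).Finite ∧
          ({x ∈ typeSet L A a | f x = y}).ncard = k) →
        (∀ y ∈ typeSet L A b, ({x ∈ typeSet L A a | g x = y}).Finite ∧
          ({x ∈ typeSet L A a | g x = y}).ncard = ℓ) →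
        k = ℓ) :
    Unimodular L (M := M) κ := by
  rw [unimodular_iff_relIndex hκ hhom]
  intro A hA n a b hab h1 h2
  rw [typeSet_eq_orbit (hhom A hA)] at hab
  let c := Fin.append a b
  have hca : c ∘ Fin.castAdd n = a := funext (Fin.append_left a b)
  have hcb : c ∘ Fin.natAdd n = b := funext (Fin.append_right a b)
  have fiber : ∀ (e : Fin n → Fin (n + n)) (k : ℕ), c ∘ e ∈ orbit (autFixing L A) a →
      (stabilizer (autFixing L A) c).relIndex (stabilizer (autFixing L A) (c ∘ e)) = k → k ≠ 0 →
      ∀ y ∈ typeSet L A a, ({x ∈ typeSet L A c | x ∘ e = y}).Finite ∧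
        ({x ∈ typeSet L A c | x ∘ e = y}).ncard = k := by
    intro e k he hk hk0 y hy
    rw [typeSet_eq_orbit (hhom A hA), ← orbit_eq_iff.2 he] at hy
    have := (ncard_orbit_comp_fiber c e hy).trans hk
    rw [typeSet_eq_orbit (hhom A hA)]
    exact ⟨Set.finite_of_ncard_ne_zero (this.trans_ne hk0), this⟩
  have maps : ∀ e : Fin n → Fin (n + n), c ∘ e ∈ orbit (autFixing L A) a →
      Set.MapsTo (· ∘ e) (typeSet L A c) (typeSet L A a) := by
    intro e he x hx
    rw [typeSet_eq_orbit (hhom A hA)] at hx ⊢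
    obtain ⟨σ, rfl⟩ := hx
    rw [← orbit_eq_iff.2 he]
    exact mem_orbit (c ∘ e) σ
  have hca' : c ∘ Fin.castAdd n ∈ orbit (autFixing L A) a := hca.symm ▸ mem_orbit_self a
  have hcb' : c ∘ Fin.natAdd n ∈ orbit (autFixing L A) a := hcb.symm ▸ hab
  refine (hfun A hA (n + n) n c a (· ∘ Fin.natAdd n) (· ∘ Fin.castAdd n) _ _ (maps _ hcb')
    (maps _ hca') (relativelyDefinableFn_comp _ _ _) (relativelyDefinableFn_comp _ _ _)
    (fiber _ _ hcb' ?_ h1) (fiber _ _ hca' ?_ h2))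
  · rw [hcb, stabilizer_append, Subgroup.inf_relIndex_right]
  · rw [hca, stabilizer_append, Subgroup.inf_relIndex_left]

end Equivalences

/-- For a `κ`-saturated strongly `κ`-homogeneous structure (`κ > |L|` uncountable),
unimodularity, correspondence unimodularity for complete types, and functional unimodularity
for complete types are all equivalent. -/
theorem statement0 (L : FirstOrder.Language.{u, u}) (M : Type u) [L.Structure M]
    (κ : Cardinal.{u}) (hκ : Cardinal.aleph0 < κ) (hLκ : L.card < κ)
    (hsat : Saturated L (M := M) κ)
    (hhom : ∀ A : Set M, Cardinal.mk A < κ → StronglyHomogeneousOver L A) :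
    (Unimodular L (M := M) κ ↔
      -- correspondence unimodularity for complete types
      (∀ A : Set M, Cardinal.mk A < κ → ∀ (n m : ℕ) (a : Fin n → M) (b : Fin m → M)
        (C₁ C₂ : Set ((Fin n → M) × (Fin m → M))) (k₁ ℓ₁ k₂ ℓ₂ : ℕ),
        IsUniformCorrespondence L A (typeSet L A a) (typeSet L A b) C₁ k₁ ℓ₁ →
        IsUniformCorrespondence L A (typeSet L A a) (typeSet L A b) C₂ k₂ ℓ₂ →
        (k₁ : ℚ) / (ℓ₁ : ℚ) = (k₂ : ℚ) / (ℓ₂ : ℚ))) ∧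
    (Unimodular L (M := M) κ ↔
      -- functional unimodularity for complete types
      (∀ A : Set M, Cardinal.mk A < κ → ∀ (n m : ℕ) (a : Fin n → M) (b : Fin m → M)
        (f g : (Fin n → M) → (Fin m → M)) (k ℓ : ℕ),
        Set.MapsTo f (typeSet L A a) (typeSet L A b) →
        Set.MapsTo g (typeSet L A a) (typeSet L A b) →
        RelativelyDefinableFn L A (typeSet L A a) (typeSet L A b) f →
        RelativelyDefinableFn L A (typeSet L A a) (typeSet L A b) g →
        (∀ y ∈ typeSet L A b, ({x ∈ typeSet L A a | f x = y}).Finite ∧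
          ({x ∈ typeSet L A a | f x = y}).ncard = k) →
        (∀ y ∈ typeSet L A b, ({x ∈ typeSet L A a | g x = y}).Finite ∧
          ({x ∈ typeSet L A a | g x = y}).ncard = ℓ) →
        k = ℓ)) := by
  have hcorr : Unimodular L (M := M) κ →
      ∀ A : Set M, Cardinal.mk A < κ → ∀ (n m : ℕ) (a : Fin n → M) (b : Fin m → M)
        (C₁ C₂ : Set ((Fin n → M) × (Fin m → M))) (k₁ ℓ₁ k₂ ℓ₂ : ℕ),
        IsUniformCorrespondence L A (typeSet L A a) (typeSet L A b) C₁ k₁ ℓ₁ →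
        IsUniformCorrespondence L A (typeSet L A a) (typeSet L A b) C₂ k₂ ℓ₂ →
        (k₁ : ℚ) / (ℓ₁ : ℚ) = (k₂ : ℚ) / (ℓ₂ : ℚ) :=
    fun hM A hA n m a b C₁ C₂ k₁ ℓ₁ k₂ ℓ₂ h₁ h₂ => hM.ratio_eq hκ hhom hA h₁ h₂
  refine ⟨⟨hcorr, fun h => ?_⟩, fun hM => ?_, unimodular_of_functional hκ hhom⟩
  · refine unimodular_of_functional hκ hhom ?_
    intro A hA n m a b f g k ℓ hf hg hfd hgd hfc hgc
    simpa using h A hA n m a b _ _ 1 k 1 ℓ (isUniformCorrespondence_graph hf hfd hfc)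
      (isUniformCorrespondence_graph hg hgd hgc)
  · intro A hA n m a b f g k ℓ hf hg hfd hgd hfc hgc
    simpa using hcorr hM A hA n m a b _ _ 1 k 1 ℓ (isUniformCorrespondence_graph hf hfd hfc)
      (isUniformCorrespondence_graph hg hgd hgc)

end Unimod
end

section
/- For any L-structure M, the following are equivalent: (1) (functional unimodularity) for all definable (with parameters) sets X and Y with Y nonempty and all definable functions f, g : X → Y such that every fibre f⁻¹(y) (y ∈ Y) has exactly k elements and every fibre g⁻¹(y) (y ∈ Y) has exactly ℓ elements, one has k = ℓ; (2) (correspondence unimodularity) for all definable sets X, Y and any two uniform definable correspondences C₁, C₂ between X and Y, one has m_{C₁} = m_{C₂}. -/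
open FirstOrder Set

namespace Unimod

universe u v w

variable (L : FirstOrder.Language.{u, v}) {M : Type w} [L.Structure M]

/-- A definable correspondence between definable sets `X` and `Y`, uniform with fibre sizes
`k` and `ℓ`. -/
structure IsDefUniformCorrespondence {n m : ℕ} (X : Set (Fin n → M)) (Y : Set (Fin m → M))
    (C : Set ((Fin n → M) × (Fin m → M))) (k ℓ : ℕ) : Prop where
  nonempty : C.Nonempty
  subset : C ⊆ X ×ˢ Y
  definable : (Set.univ : Set M).Definable L (pairSet C)
  k_pos : 0 < k
  l_pos : 0 < ℓ
  finite_fibers : ∀ x ∈ X, {y | (x, y) ∈ C}.Finite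
  finite_cofibers : ∀ y ∈ Y, {x | (x, y) ∈ C}.Finite
  fiber_card : ∀ x ∈ X, {y | (x, y) ∈ C}.ncard = k
  cofiber_card : ∀ y ∈ Y, {x | (x, y) ∈ C}.ncard = ℓ

/-- The graph of a function `f` on the set `X`, as a set of `Fin n ⊕ Fin m`-indexed tuples. -/
def graphOn {M : Type w} {n m : ℕ} (X : Set (Fin n → M)) (f : (Fin n → M) → (Fin m → M)) :
    Set ((Fin n ⊕ Fin m) → M) :=
  {v | v ∘ Sum.inl ∈ X ∧ f (v ∘ Sum.inl) = v ∘ Sum.inr}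

/-- Equality of two finite subtuples of a tuple is a definable condition. -/
theorem definable_comp_eq_comp (A : Set M) {ι κ : Type*} [Finite κ] (p q : κ → ι) :
    A.Definable L {v : ι → M | v ∘ p = v ∘ q} := by
  have h : {v : ι → M | v ∘ p = v ∘ q} = ⋂ i : κ, {v : ι → M | v (p i) = v (q i)} := by
    ext v
    simp [funext_iff]
  rw [h]
  refine Set.definable_iInter_of_finite fun i => ?_
  refine ⟨(FirstOrder.Language.Term.var (p i)).equal (FirstOrder.Language.Term.var (q i)), ?_⟩
  ext v
  simp

/-- The graph of a coordinate projection on a definable set is definable. -/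
theorem definable_graphOn_comp (A : Set M) {n m : ℕ} {X : Set (Fin n → M)}
    (hX : A.Definable L X) (p : Fin m → Fin n) :
    A.Definable L (graphOn X fun v => v ∘ p) :=
  (hX.preimage_comp Sum.inl).inter (definable_comp_eq_comp L A (Sum.inl ∘ p) Sum.inr)

/-- Counting pairs whose first entry lies in a set of size `k` and whose second entry lies in a
fibre of size `l`. -/
theorem finite_and_ncard_fiberwise {β γ : Type*} {S : Set β} {T : β → Set γ} {k l : ℕ}
    (hS : S.Finite) (hk : S.ncard = k) (hT : ∀ b ∈ S, (T b).Finite)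
    (hl : ∀ b ∈ S, (T b).ncard = l) :
    {p : β × γ | p.1 ∈ S ∧ p.2 ∈ T p.1}.Finite ∧
      {p : β × γ | p.1 ∈ S ∧ p.2 ∈ T p.1}.ncard = k * l := by
  have : Finite S := hS
  have : ∀ b : S, Finite (T b) := fun b => hT b b.2
  have : Fintype S := Fintype.ofFinite S
  let e : {p : β × γ | p.1 ∈ S ∧ p.2 ∈ T p.1} ≃ Σ b : S, T b :=
    { toFun := fun p => ⟨⟨p.1.1, p.2.1⟩, ⟨p.1.2, p.2.2⟩⟩
      invFun := fun s => ⟨(s.1, s.2), s.1.2, s.2.2⟩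
      left_inv := fun _ => rfl
      right_inv := fun _ => rfl }
  refine ⟨Set.finite_coe_iff.mp (Finite.of_equiv _ e.symm), ?_⟩
  rw [← Nat.card_coe_set_eq, Nat.card_congr e, Nat.card_sigma]
  simp only [Nat.card_coe_set_eq]
  rw [Finset.sum_congr rfl fun b _ => hl b.1 b.2, Finset.sum_const, Finset.card_univ,
    ← Nat.card_eq_fintype_card, Nat.card_coe_set_eq, hk, smul_eq_mul]

/-- The number of tuples `v` with a prescribed subtuple `v ∘ a = x`, whose remaining two
subtuples lie in a set of size `k` and in fibres of size `l`, respectively. -/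
theorem finite_and_ncard_tuples {M ι α β γ : Type*} (a : α → ι) (b : β → ι) (c : γ → ι)
    (hbij : Function.Bijective (Sum.elim a (Sum.elim b c)))
    (x : α → M) {S : Set (β → M)} {T : (β → M) → Set (γ → M)} {k l : ℕ}
    (hS : S.Finite) (hk : S.ncard = k) (hT : ∀ y ∈ S, (T y).Finite)
    (hl : ∀ y ∈ S, (T y).ncard = l) :
    {v : ι → M | v ∘ a = x ∧ v ∘ b ∈ S ∧ v ∘ c ∈ T (v ∘ b)}.Finite ∧
      {v : ι → M | v ∘ a = x ∧ v ∘ b ∈ S ∧ v ∘ c ∈ T (v ∘ b)}.ncard = k * l := by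
  obtain ⟨hfin, hcard⟩ := finite_and_ncard_fiberwise hS hk hT hl
  let e := Equiv.ofBijective _ hbij
  let F : (β → M) × (γ → M) → ι → M := fun p => Sum.elim x (Sum.elim p.1 p.2) ∘ e.symm
  have hFe : ∀ p s, F p (Sum.elim a (Sum.elim b c) s) = Sum.elim x (Sum.elim p.1 p.2) s :=
    fun p s => congrArg _ (e.symm_apply_apply s)
  have hFa : ∀ p, F p ∘ a = x := fun p => funext fun i => hFe p (Sum.inl i)
  have hFb : ∀ p, F p ∘ b = p.1 := fun p => funext fun i => hFe p (Sum.inr (Sum.inl i))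
  have hFc : ∀ p, F p ∘ c = p.2 := fun p => funext fun i => hFe p (Sum.inr (Sum.inr i))
  have hinj : Function.Injective F := fun p q h =>
    Prod.ext (by rw [← hFb p, h, hFb]) (by rw [← hFc p, h, hFc])
  have himage : {v : ι → M | v ∘ a = x ∧ v ∘ b ∈ S ∧ v ∘ c ∈ T (v ∘ b)} =
      F '' {p | p.1 ∈ S ∧ p.2 ∈ T p.1} := by
    ext v
    constructor
    · rintro ⟨hx, hy, hz⟩
      refine ⟨(v ∘ b, v ∘ c), ⟨hy, hz⟩, funext fun i => ?_⟩
      obtain ⟨s, rfl⟩ := hbij.2 i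
      rw [hFe]
      subst hx
      rcases s with i | i | i <;> rfl
    · rintro ⟨p, ⟨hy, hz⟩, rfl⟩
      exact ⟨hFa p, by rwa [hFb], by rwa [hFb, hFc]⟩
  rw [himage, Set.ncard_image_of_injective _ hinj]
  exact ⟨hfin.image F, hcard⟩

/-- A definable function with all fibres of size `k > 0` gives a uniform correspondence. -/
theorem isDefUniformCorrespondence_graph {n m : ℕ} {X : Set (Fin n → M)} {Y : Set (Fin m → M)}
    {f : (Fin n → M) → (Fin m → M)} {k : ℕ} (hX : X.Nonempty) (hf : Set.MapsTo f X Y)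
    (hdef : (Set.univ : Set M).Definable L (graphOn X f)) (hk : 0 < k)
    (hfib : ∀ y ∈ Y, {x ∈ X | f x = y}.Finite ∧ {x ∈ X | f x = y}.ncard = k) :
    IsDefUniformCorrespondence L X Y {p | p.1 ∈ X ∧ f p.1 = p.2} 1 k := by
  have hsingle : ∀ x ∈ X, {y | (x, y) ∈ {p : (Fin n → M) × (Fin m → M) |
      p.1 ∈ X ∧ f p.1 = p.2}} = {f x} := by
    intro x hx
    ext y
    simp [hx, eq_comm]
  obtain ⟨x, hx⟩ := hX
  exact
    { nonempty := ⟨(x, f x), hx, rfl⟩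
      subset := fun p hp => ⟨hp.1, hp.2 ▸ hf hp.1⟩
      definable := hdef
      k_pos := one_pos
      l_pos := hk
      finite_fibers := fun x hx => by rw [hsingle x hx]; exact Set.finite_singleton _
      finite_cofibers := fun y hy => (hfib y hy).1
      fiber_card := fun x hx => by rw [hsingle x hx]; exact Set.ncard_singleton _
      cofiber_card := fun y hy => (hfib y hy).2 }

/-- Functional unimodularity (for definable sets) is equivalent to
correspondence unimodularity (for definable sets). -/
theorem statement1 (L : FirstOrder.Language.{u, v}) (M : Type w) [L.Structure M] :
    -- functional unimodularity
    (∀ (n m : ℕ) (X : Set (Fin n → M)) (Y : Set (Fin m → M)),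
      (Set.univ : Set M).Definable L X → (Set.univ : Set M).Definable L Y → Y.Nonempty →
      ∀ (f g : (Fin n → M) → (Fin m → M)) (k ℓ : ℕ),
        Set.MapsTo f X Y → Set.MapsTo g X Y →
        (Set.univ : Set M).Definable L (graphOn X f) →
        (Set.univ : Set M).Definable L (graphOn X g) →
        (∀ y ∈ Y, ({x ∈ X | f x = y}).Finite ∧ ({x ∈ X | f x = y}).ncard = k) →
        (∀ y ∈ Y, ({x ∈ X | g x = y}).Finite ∧ ({x ∈ X | g x = y}).ncard = ℓ) →
        k = ℓ) ↔
    -- correspondence unimodularity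
    (∀ (n m : ℕ) (X : Set (Fin n → M)) (Y : Set (Fin m → M)),
      (Set.univ : Set M).Definable L X → (Set.univ : Set M).Definable L Y →
      ∀ (C₁ C₂ : Set ((Fin n → M) × (Fin m → M))) (k₁ ℓ₁ k₂ ℓ₂ : ℕ),
        IsDefUniformCorrespondence L X Y C₁ k₁ ℓ₁ →
        IsDefUniformCorrespondence L X Y C₂ k₂ ℓ₂ →
        (k₁ : ℚ) / (ℓ₁ : ℚ) = (k₂ : ℚ) / (ℓ₂ : ℚ)) := by
  constructor
  · intro H n m X Y hX _ C₁ C₂ k₁ ℓ₁ k₂ ℓ₂ h₁ h₂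
    let e : Fin n ⊕ (Fin m ⊕ Fin n) ≃ Fin (n + (m + n)) :=
      (Equiv.sumCongr (Equiv.refl _) finSumFinEquiv).trans finSumFinEquiv
    let a : Fin n → Fin (n + (m + n)) := fun i => e (Sum.inl i)
    let b : Fin m → Fin (n + (m + n)) := fun i => e (Sum.inr (Sum.inl i))
    let c : Fin n → Fin (n + (m + n)) := fun i => e (Sum.inr (Sum.inr i))
    have habc : Function.Bijective (Sum.elim a (Sum.elim b c)) := by
      convert e.bijective using 1
      ext (i | i | i) <;> rfl
    have hcba : Function.Bijective (Sum.elim c (Sum.elim b a)) := by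
      let swap : Fin n ⊕ (Fin m ⊕ Fin n) ≃ Fin n ⊕ (Fin m ⊕ Fin n) :=
        ((Equiv.sumComm _ _).trans (Equiv.sumCongr (Equiv.sumComm _ _) (Equiv.refl _))).trans
          (Equiv.sumAssoc _ _ _)
      convert (swap.trans e).bijective using 1
      ext (i | i | i) <;> rfl
    -- the fibre product of the two correspondences over `Y`
    let E : Set (Fin (n + (m + n)) → M) := {v | (v ∘ a, v ∘ b) ∈ C₁ ∧ (v ∘ c, v ∘ b) ∈ C₂}
    have hE : (Set.univ : Set M).Definable L E :=
      (h₁.definable.preimage_comp (Sum.elim a b)).inter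
        (h₂.definable.preimage_comp (Sum.elim c b))
    obtain ⟨p, hp⟩ := h₁.nonempty
    have key : k₁ * ℓ₂ = k₂ * ℓ₁ := by
      refine H _ _ E X hE hX ⟨p.1, (h₁.subset hp).1⟩ (fun v => v ∘ a) (fun v => v ∘ c) _ _
        (fun v hv => (h₁.subset hv.1).1) (fun v hv => (h₂.subset hv.2).1)
        (definable_graphOn_comp L _ hE a) (definable_graphOn_comp L _ hE c)
        (fun x hx => ?_) (fun x hx => ?_)
      · have h := finite_and_ncard_tuples a b c habc x
          (T := fun y => {x' | (x', y) ∈ C₂}) (h₁.finite_fibers x hx)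
          (h₁.fiber_card x hx) (fun y hy => h₂.finite_cofibers y (h₁.subset hy).2)
          (fun y hy => h₂.cofiber_card y (h₁.subset hy).2)
        convert h using 3 <;>
        · ext v
          constructor
          · rintro ⟨⟨h1, h2⟩, rfl⟩
            exact ⟨rfl, h1, h2⟩
          · rintro ⟨rfl, h1, h2⟩
            exact ⟨⟨h1, h2⟩, rfl⟩
      · have h := finite_and_ncard_tuples c b a hcba x
          (T := fun y => {x' | (x', y) ∈ C₁}) (h₂.finite_fibers x hx)
          (h₂.fiber_card x hx) (fun y hy => h₁.finite_cofibers y (h₂.subset hy).2)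
          (fun y hy => h₁.cofiber_card y (h₂.subset hy).2)
        convert h using 3 <;>
        · ext v
          constructor
          · rintro ⟨⟨h1, h2⟩, rfl⟩
            exact ⟨rfl, h2, h1⟩
          · rintro ⟨rfl, h2, h1⟩
            exact ⟨⟨h1, h2⟩, rfl⟩
    have hℓ₁ : (ℓ₁ : ℚ) ≠ 0 := by exact_mod_cast h₁.l_pos.ne'
    have hℓ₂ : (ℓ₂ : ℚ) ≠ 0 := by exact_mod_cast h₂.l_pos.ne'
    rw [div_eq_div_iff hℓ₁ hℓ₂]
    exact_mod_cast key
  · intro H n m X Y hX hY hYne f g k ℓ hf hg hfdef hgdef hfk hgℓ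
    obtain ⟨y, hy⟩ := hYne
    rcases X.eq_empty_or_nonempty with rfl | hXne
    · rw [← (hfk y hy).2, ← (hgℓ y hy).2]
      simp
    · obtain ⟨x, hx⟩ := hXne
      have hk : 0 < k := by
        rw [← (hfk _ (hf hx)).2, Set.ncard_pos (hfk _ (hf hx)).1]
        exact ⟨x, hx, rfl⟩
      have hℓ : 0 < ℓ := by
        rw [← (hgℓ _ (hg hx)).2, Set.ncard_pos (hgℓ _ (hg hx)).1]
        exact ⟨x, hx, rfl⟩
      have h := H n m X Y hX hY _ _ 1 k 1 ℓ
        (isDefUniformCorrespondence_graph L ⟨x, hx⟩ hf hfdef hk hfk)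
        (isDefUniformCorrespondence_graph L ⟨x, hx⟩ hg hgdef hℓ hgℓ)
      simpa using h

end Unimod
end

section
/- For any L-structure M, the following are equivalent: (1) every uniform definable correspondence between a definable set X ⊆ M^n and itself is balanced; (2) for all definable sets X ⊆ M^n and Y ⊆ M^m, any two uniform definable correspondences C₁, C₂ between X and Y have the same ratio m_{C₁} = m_{C₂}. -/
open FirstOrder Set

namespace Unimod

universe u v w

variable (L : FirstOrder.Language.{u, v}) {M : Type w} [L.Structure M]

section

variable {L}

/-- The converse of a uniform definable correspondence is one, with the fibre sizes swapped. -/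
theorem IsDefUniformCorrespondence.swap {n m : ℕ} {X : Set (Fin n → M)} {Y : Set (Fin m → M)}
    {C : Set ((Fin n → M) × (Fin m → M))} {k ℓ : ℕ}
    (h : IsDefUniformCorrespondence L X Y C k ℓ) :
    IsDefUniformCorrespondence L Y X (Prod.swap ⁻¹' C) ℓ k where
  nonempty := let ⟨c, hc⟩ := h.nonempty; ⟨c.swap, by simpa using hc⟩
  subset := fun _ hp => (h.subset hp).symm
  definable := h.definable.preimage_comp Sum.swap
  k_pos := h.l_pos
  l_pos := h.k_pos
  finite_fibers := h.finite_cofibers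
  finite_cofibers := h.finite_fibers
  fiber_card := h.cofiber_card
  cofiber_card := h.fiber_card

/-- The product of two sets of tuples, as a set of concatenated tuples. -/
def appendProd {n m : ℕ} (X : Set (Fin n → M)) (Y : Set (Fin m → M)) : Set (Fin (n + m) → M) :=
  {z | z ∘ Fin.castAdd m ∈ X ∧ z ∘ Fin.natAdd n ∈ Y}

theorem definable_appendProd {A : Set M} {n m : ℕ} {X : Set (Fin n → M)} {Y : Set (Fin m → M)}
    (hX : A.Definable L X) (hY : A.Definable L Y) : A.Definable L (appendProd X Y) :=
  (hX.preimage_comp (Fin.castAdd m)).inter (hY.preimage_comp (Fin.natAdd n))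

theorem appendProd_eq_image {n m : ℕ} (X : Set (Fin n → M)) (Y : Set (Fin m → M)) :
    appendProd X Y = Fin.appendEquiv n m '' (X ×ˢ Y) := by
  rw [Equiv.image_eq_preimage_symm]
  rfl

theorem ncard_appendProd {n m : ℕ} (X : Set (Fin n → M)) (Y : Set (Fin m → M)) :
    (appendProd X Y).ncard = X.ncard * Y.ncard := by
  rw [appendProd_eq_image, ncard_image_of_injective _ (Equiv.injective _), ncard_prod]

theorem finite_appendProd {n m : ℕ} {X : Set (Fin n → M)} {Y : Set (Fin m → M)}
    (hX : X.Finite) (hY : Y.Finite) : (appendProd X Y).Finite := by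
  rw [appendProd_eq_image]
  exact (hX.prod hY).image _

/-- Two correspondences between `X` and `Y` give a correspondence between `X × Y` and itself,
relating `(x, y)` to `(x', y')` when `(x, y') ∈ C₁` and `(x', y) ∈ C₂`. -/
def crossCorrespondence {n m : ℕ} (C₁ C₂ : Set ((Fin n → M) × (Fin m → M))) :
    Set ((Fin (n + m) → M) × (Fin (n + m) → M)) :=
  {p | (p.1 ∘ Fin.castAdd m, p.2 ∘ Fin.natAdd n) ∈ C₁ ∧
    (p.2 ∘ Fin.castAdd m, p.1 ∘ Fin.natAdd n) ∈ C₂}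

theorem crossCorrespondence_fiber {n m : ℕ} (C₁ C₂ : Set ((Fin n → M) × (Fin m → M)))
    (z : Fin (n + m) → M) :
    {w | (z, w) ∈ crossCorrespondence C₁ C₂} =
      appendProd {x | (x, z ∘ Fin.natAdd n) ∈ C₂} {y | (z ∘ Fin.castAdd m, y) ∈ C₁} :=
  Set.ext fun _ => and_comm

theorem crossCorrespondence_cofiber {n m : ℕ} (C₁ C₂ : Set ((Fin n → M) × (Fin m → M)))
    (w : Fin (n + m) → M) :
    {z | (z, w) ∈ crossCorrespondence C₁ C₂} =
      appendProd {x | (x, w ∘ Fin.natAdd n) ∈ C₁} {y | (w ∘ Fin.castAdd m, y) ∈ C₂} :=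
  rfl

theorem IsDefUniformCorrespondence.cross {n m : ℕ} {X : Set (Fin n → M)} {Y : Set (Fin m → M)}
    {C₁ C₂ : Set ((Fin n → M) × (Fin m → M))} {k₁ ℓ₁ k₂ ℓ₂ : ℕ}
    (h₁ : IsDefUniformCorrespondence L X Y C₁ k₁ ℓ₁)
    (h₂ : IsDefUniformCorrespondence L X Y C₂ k₂ ℓ₂) :
    IsDefUniformCorrespondence L (appendProd X Y) (appendProd X Y)
      (crossCorrespondence C₁ C₂) (ℓ₂ * k₁) (ℓ₁ * k₂) where
  nonempty := by
    obtain ⟨⟨x, y'⟩, hc⟩ := h₁.nonempty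
    obtain ⟨⟨x', y⟩, hd⟩ := h₂.nonempty
    refine ⟨(Fin.append x y, Fin.append x' y'), ?_⟩
    simpa [crossCorrespondence, Function.comp_def] using And.intro hc hd
  subset := fun _ hp =>
    ⟨⟨(h₁.subset hp.1).1, (h₂.subset hp.2).2⟩, ⟨(h₂.subset hp.2).1, (h₁.subset hp.1).2⟩⟩
  definable :=
    (h₁.definable.preimage_comp (Sum.map (Fin.castAdd m) (Fin.natAdd n))).inter
      (h₂.definable.preimage_comp
        (Sum.elim (Sum.inr ∘ Fin.castAdd m) (Sum.inl ∘ Fin.natAdd n)))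
  k_pos := Nat.mul_pos h₂.l_pos h₁.k_pos
  l_pos := Nat.mul_pos h₁.l_pos h₂.k_pos
  finite_fibers := fun z hz => by
    rw [crossCorrespondence_fiber]
    exact finite_appendProd (h₂.finite_cofibers _ hz.2) (h₁.finite_fibers _ hz.1)
  finite_cofibers := fun w hw => by
    rw [crossCorrespondence_cofiber]
    exact finite_appendProd (h₁.finite_cofibers _ hw.2) (h₂.finite_fibers _ hw.1)
  fiber_card := fun z hz => by
    rw [crossCorrespondence_fiber, ncard_appendProd, h₂.cofiber_card _ hz.2,
      h₁.fiber_card _ hz.1]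
  cofiber_card := fun w hw => by
    rw [crossCorrespondence_cofiber, ncard_appendProd, h₁.cofiber_card _ hw.2,
      h₂.fiber_card _ hw.1]

end

/-- Every uniform definable correspondence between a definable set and itself is
balanced, if and only if any two uniform definable correspondences between two definable sets
have the same ratio. -/
theorem statement3 (L : FirstOrder.Language.{u, v}) (M : Type w) [L.Structure M] :
    (∀ (n : ℕ) (X : Set (Fin n → M)), (Set.univ : Set M).Definable L X →
      ∀ (C : Set ((Fin n → M) × (Fin n → M))) (k ℓ : ℕ),
        IsDefUniformCorrespondence L X X C k ℓ → k = ℓ) ↔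
    (∀ (n m : ℕ) (X : Set (Fin n → M)) (Y : Set (Fin m → M)),
      (Set.univ : Set M).Definable L X → (Set.univ : Set M).Definable L Y →
      ∀ (C₁ C₂ : Set ((Fin n → M) × (Fin m → M))) (k₁ ℓ₁ k₂ ℓ₂ : ℕ),
        IsDefUniformCorrespondence L X Y C₁ k₁ ℓ₁ →
        IsDefUniformCorrespondence L X Y C₂ k₂ ℓ₂ →
        (k₁ : ℚ) / (ℓ₁ : ℚ) = (k₂ : ℚ) / (ℓ₂ : ℚ)) := by
  constructor
  · intro h n m X Y hX hY C₁ C₂ k₁ ℓ₁ k₂ ℓ₂ h₁ h₂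
    have key := h _ _ (definable_appendProd hX hY) _ _ _ (h₁.cross h₂)
    have hℓ₁ : (ℓ₁ : ℚ) ≠ 0 := Nat.cast_ne_zero.2 h₁.l_pos.ne'
    have hℓ₂ : (ℓ₂ : ℚ) ≠ 0 := Nat.cast_ne_zero.2 h₂.l_pos.ne'
    rw [div_eq_div_iff hℓ₁ hℓ₂, mul_comm (k₁ : ℚ), mul_comm (k₂ : ℚ)]
    exact_mod_cast key
  · intro h n X hX C k ℓ hC
    have key := h n n X X hX hX _ _ _ _ _ _ hC hC.swap
    have hk : (k : ℚ) ≠ 0 := Nat.cast_ne_zero.2 hC.k_pos.ne'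
    have hℓ : (ℓ : ℚ) ≠ 0 := Nat.cast_ne_zero.2 hC.l_pos.ne'
    rw [div_eq_div_iff hℓ hk] at key
    exact Nat.mul_self_inj.1 (by exact_mod_cast key)

end Unimod
end

section
/- Let L be a first-order language, κ > |L| an uncountable cardinal, and M a strongly κ-homogeneous L-structure. Then M is unimodular if and only if for every A ⊆ M with |A| < κ, every complete type over A is measurable over A. -/
open FirstOrder Set

namespace Unimod

universe u v w

variable (L : FirstOrder.Language.{u, v}) {M : Type w} [L.Structure M]

section SameType

variable {L} {A : Set M} {α β : Type*}

theorem SameType.refl (a : α → M) : SameType L A a a := fun _ => Iff.rfl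

theorem SameType.symm {a b : α → M} (h : SameType L A a b) : SameType L A b a :=
  fun φ => (h φ).symm

theorem SameType.trans {a b c : α → M} (h : SameType L A a b) (h' : SameType L A b c) :
    SameType L A a c := fun φ => (h φ).trans (h' φ)

theorem SameType.comp {a b : α → M} (h : SameType L A a b) (f : β → α) :
    SameType L A (a ∘ f) (b ∘ f) := by
  intro φ
  have := h (φ.relabel (Sum.map id f))
  simpa only [Language.Formula.realize_relabel, Sum.elim_comp_map, Function.comp_id] using this

theorem sameType_comp_equiv (σ : M ≃[L] M) (hσ : ∀ x ∈ A, σ x = x) (a : α → M) :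
    SameType L A a (σ ∘ a) := by
  intro φ
  have h : (Sum.elim (fun x : A => (x : M)) (σ ∘ a)) = σ ∘ Sum.elim (fun x : A => (x : M)) a := by
    funext i
    rcases i with i | i
    · exact (hσ i i.2).symm
    · rfl
  rw [h, Language.StrongHomClass.realize_formula]

theorem sameType_sumElim_swap {a x : α → M} {b y : β → M} :
    SameType L A (Sum.elim a b) (Sum.elim x y) ↔ SameType L A (Sum.elim b a) (Sum.elim y x) := by
  constructor <;> intro h <;> simpa using h.comp Sum.swap

theorem SameType.sum_left {a x : α → M} {b y : β → M}
    (h : SameType L A (Sum.elim a b) (Sum.elim x y)) : SameType L A a x := by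
  simpa using h.comp Sum.inl

theorem SameType.sum_right {a x : α → M} {b y : β → M}
    (h : SameType L A (Sum.elim a b) (Sum.elim x y)) : SameType L A b y := by
  simpa using h.comp Sum.inr

theorem StronglyHomogeneousOver.exists_equiv {n : ℕ} (hA : StronglyHomogeneousOver L A)
    {a b : Fin n → M} (h : SameType L A a b) :
    ∃ σ : M ≃[L] M, (∀ x ∈ A, σ x = x) ∧ σ ∘ a = b := by
  obtain ⟨σ, h₁, h₂⟩ := hA n a b h
  exact ⟨σ, h₁, funext h₂⟩

theorem StronglyHomogeneousOver.exists_equiv_sum {n m : ℕ} (hA : StronglyHomogeneousOver L A)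
    {a x : Fin n → M} {b y : Fin m → M} (h : SameType L A (Sum.elim a b) (Sum.elim x y)) :
    ∃ σ : M ≃[L] M, (∀ z ∈ A, σ z = z) ∧ σ ∘ a = x ∧ σ ∘ b = y := by
  obtain ⟨σ, h₁, h₂⟩ := hA _ _ _ (h.comp finSumFinEquiv.symm)
  refine ⟨σ, h₁, funext fun i => ?_, funext fun i => ?_⟩
  · simpa using h₂ (finSumFinEquiv (Sum.inl i))
  · simpa using h₂ (finSumFinEquiv (Sum.inr i))

theorem TypeDefinable.mem_of_sameType {s : Set (α → M)} (hs : TypeDefinable L A s) {v w : α → M}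
    (h : SameType L A v w) (hv : v ∈ s) : w ∈ s := by
  obtain ⟨S, hS, rfl⟩ := hs
  intro t ht
  obtain ⟨φ, rfl⟩ := Set.definable_iff_exists_formula_sum.1 (hS t ht)
  exact (h φ).1 (hv _ ht)

theorem typeDefinable_typeSet (a : α → M) : TypeDefinable L A (typeSet L A a) := by
  refine ⟨{t | a ∈ t ∧ A.Definable L t}, fun t ht => ht.2, Set.ext fun b => ⟨?_, ?_⟩⟩
  · rintro hb t ⟨ha, ht⟩
    obtain ⟨φ, rfl⟩ := Set.definable_iff_exists_formula_sum.1 ht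
    exact (hb φ).1 ha
  · intro hb φ
    have key : ∀ ψ : L.Formula (↥A ⊕ α), ψ.Realize (Sum.elim (fun x => (x : M)) a) →
        ψ.Realize (Sum.elim (fun x => (x : M)) b) := fun ψ hψ =>
      hb {v | ψ.Realize (Sum.elim (fun x => (x : M)) v)}
        ⟨hψ, Set.definable_iff_exists_formula_sum.2 ⟨ψ, rfl⟩⟩
    refine ⟨key φ, fun h => by_contra fun h' => ?_⟩
    have := key φ.not (Language.Formula.realize_not.2 h')
    exact Language.Formula.realize_not.1 this h

end SameType

section PairClass

variable {L} {A : Set M} {n m : ℕ}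

theorem mem_pairClass {c p : (Fin n → M) × (Fin m → M)} :
    p ∈ pairClass L A c ↔ SameType L A (Sum.elim c.1 c.2) (Sum.elim p.1 p.2) := Iff.rfl

theorem pairClass_eq_iff {c p : (Fin n → M) × (Fin m → M)} :
    pairClass L A p = pairClass L A c ↔
      SameType L A (Sum.elim c.1 c.2) (Sum.elim p.1 p.2) := by
  constructor
  · intro h
    rw [← mem_pairClass, ← h]
    exact SameType.refl _
  · intro h
    ext q
    exact ⟨fun hq => h.trans hq, fun hq => h.symm.trans hq⟩

theorem pairSet_pairClass (c : (Fin n → M) × (Fin m → M)) :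
    pairSet (pairClass L A c) = typeSet L A (Sum.elim c.1 c.2) := by
  ext v
  simp only [pairSet, pairClass, typeSet, mem_ofPred_eq, Sum.elim_comp_inl_inr]

/-- The fibre of the class of `(a, b)` over a conjugate of `a` is a conjugate of the set of
realizations of the type of `b` over `A` and `a`. -/
theorem exists_fiber_pairClass_eq_image {a x : Fin n → M} (b : Fin m → M)
    (hA : StronglyHomogeneousOver L A) (hAa : StronglyHomogeneousOver L (A ∪ range a))
    (hx : SameType L A a x) :
    ∃ σ : M ≃[L] M, {y | SameType L A (Sum.elim a b) (Sum.elim x y)} =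
      (fun y => σ ∘ y) '' typeSet L (A ∪ range a) b := by
  obtain ⟨σ, hσA, rfl⟩ := hA.exists_equiv hx
  refine ⟨σ, Set.ext fun y => ⟨fun hy => ?_, ?_⟩⟩
  · obtain ⟨τ, hτA, hτa, rfl⟩ := hA.exists_equiv_sum hy
    refine ⟨(σ.symm.comp τ) ∘ b, sameType_comp_equiv _ ?_ _, ?_⟩
    · rintro z (hz | ⟨i, rfl⟩)
      · rw [Language.Equiv.comp_apply, hτA z hz]
        conv_lhs => rw [← hσA z hz]
        exact σ.symm_apply_apply z
      · rw [Language.Equiv.comp_apply, show τ (a i) = σ (a i) from congrFun hτa i]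
        exact σ.symm_apply_apply _
    · funext i
      simp
  · rintro ⟨y, hy, rfl⟩
    obtain ⟨τ, hτ, rfl⟩ := hAa.exists_equiv hy
    have h := sameType_comp_equiv (σ.comp τ)
      (fun z hz => by rw [Language.Equiv.comp_apply, hτ z (.inl hz), hσA z hz]) (Sum.elim a b)
    have hτa : τ ∘ a = a := funext fun i => hτ _ (.inr ⟨i, rfl⟩)
    have e : (σ.comp τ) ∘ Sum.elim a b = Sum.elim (σ ∘ a) (σ ∘ τ ∘ b) := by
      nth_rw 2 [← hτa]
      funext i
      rcases i with i | i <;> simp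
    rwa [e] at h

theorem comp_equiv_injective (σ : M ≃[L] M) {α : Type*} :
    Function.Injective fun y : α → M => σ ∘ y :=
  σ.injective.comp_left

variable {a x : Fin n → M} {b y : Fin m → M}

theorem ncard_fiber_pairClass
    (hA : StronglyHomogeneousOver L A) (hAa : StronglyHomogeneousOver L (A ∪ range a))
    (hx : SameType L A a x) :
    {y | SameType L A (Sum.elim a b) (Sum.elim x y)}.ncard =
      (typeSet L (A ∪ range a) b).ncard := by
  obtain ⟨σ, h⟩ := exists_fiber_pairClass_eq_image b hA hAa hx
  rw [h, ncard_image_of_injective _ (comp_equiv_injective σ)]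

theorem finite_fiber_pairClass
    (hA : StronglyHomogeneousOver L A) (hAa : StronglyHomogeneousOver L (A ∪ range a))
    (hx : SameType L A a x) :
    {y | SameType L A (Sum.elim a b) (Sum.elim x y)}.Finite ↔
      (typeSet L (A ∪ range a) b).Finite := by
  obtain ⟨σ, h⟩ := exists_fiber_pairClass_eq_image b hA hAa hx
  rw [h, finite_image_iff (comp_equiv_injective σ).injOn]

theorem ncard_cofiber_pairClass
    (hA : StronglyHomogeneousOver L A) (hAb : StronglyHomogeneousOver L (A ∪ range b))
    (hy : SameType L A b y) :
    {x | SameType L A (Sum.elim a b) (Sum.elim x y)}.ncard =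
      (typeSet L (A ∪ range b) a).ncard := by
  simp_rw [sameType_sumElim_swap (a := a)]
  exact ncard_fiber_pairClass hA hAb hy

theorem finite_cofiber_pairClass
    (hA : StronglyHomogeneousOver L A) (hAb : StronglyHomogeneousOver L (A ∪ range b))
    (hy : SameType L A b y) :
    {x | SameType L A (Sum.elim a b) (Sum.elim x y)}.Finite ↔
      (typeSet L (A ∪ range b) a).Finite := by
  simp_rw [sameType_sumElim_swap (a := a)]
  exact finite_fiber_pairClass hA hAb hy

/-- The class over `A` of a pair of interalgebraic tuples is a uniform correspondence. -/
theorem isUniformCorrespondence_pairClass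
    (hA : StronglyHomogeneousOver L A) (hAa : StronglyHomogeneousOver L (A ∪ range a))
    (hAb : StronglyHomogeneousOver L (A ∪ range b))
    (hfa : (typeSet L (A ∪ range b) a).Finite) (hfb : (typeSet L (A ∪ range a) b).Finite) :
    IsUniformCorrespondence L A (typeSet L A a) (typeSet L A b) (pairClass L A (a, b))
      (typeSet L (A ∪ range a) b).ncard (typeSet L (A ∪ range b) a).ncard where
  nonempty := ⟨(a, b), SameType.refl _⟩
  subset := fun _ hp => ⟨SameType.sum_left hp, SameType.sum_right hp⟩
  typeDefinable := by
    rw [pairSet_pairClass]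
    exact typeDefinable_typeSet _
  finite_fibers := fun _ hx => (finite_fiber_pairClass hA hAa hx).2 hfb
  finite_cofibers := fun _ hy => (finite_cofiber_pairClass hA hAb hy).2 hfa
  k_pos := (ncard_pos hfb).2 ⟨b, SameType.refl b⟩
  l_pos := (ncard_pos hfa).2 ⟨a, SameType.refl a⟩
  fiber_card := fun _ hx => ncard_fiber_pairClass hA hAa hx
  cofiber_card := fun _ hy => ncard_cofiber_pairClass hA hAb hy

end PairClass

section Counting

/-- Two finite sets on which given maps have the same image and equinumerous fibres are
equinumerous. -/
theorem ncard_eq_ncard_of_fibers {α β γ : Type*} {s : Set α} {t : Set β} (hs : s.Finite)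
    (ht : t.Finite) (f : α → γ) (g : β → γ) (himg : f '' s = g '' t)
    (hfib : ∀ i ∈ s, {j ∈ s | f j = f i}.ncard = {j ∈ t | g j = f i}.ncard) :
    s.ncard = t.ncard := by
  classical
  lift s to Finset α using hs
  lift t to Finset β using ht
  have himg' : s.image f = t.image g := by
    apply Finset.coe_injective
    simpa using himg
  rw [ncard_coe_finset, ncard_coe_finset, Finset.card_eq_sum_card_image f s,
    Finset.card_eq_sum_card_image g t, ← himg']
  refine Finset.sum_congr rfl fun c hc => ?_
  obtain ⟨i, hi, rfl⟩ := Finset.mem_image.1 hc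
  rw [← ncard_coe_finset, ← ncard_coe_finset]
  simpa using hfib i hi

end Counting

variable {L} in
/-- A correspondence from the realizations of a type to themselves is a disjoint union of classes
of pairs, each of which is balanced by unimodularity. -/
theorem Unimodular.measurableOver_typeSet {κ : Cardinal.{w}} (hu : Unimodular L (M := M) κ)
    {A : Set M} (hAκ : Cardinal.mk A < κ) (hA : StronglyHomogeneousOver L A)
    (hAr : ∀ (n : ℕ) (a : Fin n → M), StronglyHomogeneousOver L (A ∪ range a))
    {n : ℕ} (a : Fin n → M) : MeasurableOver L A (typeSet L A a) := by
  intro C k l hC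
  have hinv : ∀ {p q : (Fin n → M) × (Fin n → M)}, p ∈ C →
      SameType L A (Sum.elim p.1 p.2) (Sum.elim q.1 q.2) → q ∈ C := fun {p q} hp h => by
    have := hC.typeDefinable.mem_of_sameType h (show _ ∈ pairSet C by simpa [pairSet] using hp)
    simpa [pairSet] using this
  have haX : a ∈ typeSet L A a := SameType.refl a
  rw [← hC.fiber_card a haX, ← hC.cofiber_card a haX]
  refine ncard_eq_ncard_of_fibers (hC.finite_fibers a haX) (hC.finite_cofibers a haX)
    (fun y => pairClass L A (a, y)) (fun x => pairClass L A (x, a)) ?_ ?_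
  · ext D
    constructor
    · rintro ⟨y, hy, rfl⟩
      obtain ⟨σ, hσ, h⟩ := hA.exists_equiv (hC.subset hy).2.symm
      have hs := sameType_comp_equiv σ hσ (Sum.elim a y)
      rw [Sum.comp_elim, h] at hs
      exact ⟨σ ∘ a, hinv hy hs, pairClass_eq_iff.2 hs⟩
    · rintro ⟨x, hx, rfl⟩
      obtain ⟨σ, hσ, h⟩ := hA.exists_equiv (hC.subset hx).1.symm
      have hs := sameType_comp_equiv σ hσ (Sum.elim x a)
      rw [Sum.comp_elim, h] at hs
      exact ⟨σ ∘ a, hinv hx hs, pairClass_eq_iff.2 hs⟩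
  · intro y hy
    have hay : SameType L A a y := (hC.subset hy).2
    have e₁ : {y' ∈ {y | (a, y) ∈ C} | pairClass L A (a, y') = pairClass L A (a, y)} =
        {y' | SameType L A (Sum.elim a y) (Sum.elim a y')} := by
      ext y'
      exact ⟨fun h => pairClass_eq_iff.1 h.2, fun h => ⟨hinv hy h, pairClass_eq_iff.2 h⟩⟩
    have e₂ : {x ∈ {x | (x, a) ∈ C} | pairClass L A (x, a) = pairClass L A (a, y)} =
        {x | SameType L A (Sum.elim a y) (Sum.elim x a)} := by
      ext x
      exact ⟨fun h => pairClass_eq_iff.1 h.2, fun h => ⟨hinv hy h, pairClass_eq_iff.2 h⟩⟩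
    have f₁ : {y' | SameType L A (Sum.elim a y) (Sum.elim a y')}.Finite :=
      e₁ ▸ (hC.finite_fibers a haX).subset (sep_subset _ _)
    have f₂ : {x | SameType L A (Sum.elim a y) (Sum.elim x a)}.Finite :=
      e₂ ▸ (hC.finite_cofibers a haX).subset (sep_subset _ _)
    rw [finite_fiber_pairClass hA (hAr n a) (SameType.refl a)] at f₁
    rw [finite_cofiber_pairClass hA (hAr n y) hay.symm] at f₂
    simp only [e₁, e₂]
    rw [ncard_fiber_pairClass hA (hAr n a) (SameType.refl a),
      ncard_cofiber_pairClass hA (hAr n y) hay.symm]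
    exact (hu A hAκ n a y hay f₂ f₁).symm

/-- A strongly `κ`-homogeneous structure is unimodular if and only if every
complete type over a parameter set of size `< κ` is measurable over its domain. -/
theorem statement4 (L : FirstOrder.Language.{u, u}) (M : Type u) [L.Structure M]
    (κ : Cardinal.{u}) (hκ : Cardinal.aleph0 < κ) (hLκ : L.card < κ)
    (hhom : ∀ A : Set M, Cardinal.mk A < κ → StronglyHomogeneousOver L A) :
    Unimodular L (M := M) κ ↔
      ∀ A : Set M, Cardinal.mk A < κ → ∀ (n : ℕ) (a : Fin n → M),
        MeasurableOver L A (typeSet L A a) := by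
  have hAr : ∀ A : Set M, Cardinal.mk A < κ → ∀ (n : ℕ) (a : Fin n → M),
      StronglyHomogeneousOver L (A ∪ range a) := fun A hA n a =>
    hhom _ ((Cardinal.mk_union_le _ _).trans_lt (Cardinal.add_lt_of_lt hκ.le hA
      ((Cardinal.lt_aleph0_iff_set_finite.2 (finite_range a)).trans hκ)))
  refine ⟨fun hu A hA n a => hu.measurableOver_typeSet hA (hhom A hA) (hAr A hA) a, ?_⟩
  intro hm A hA n a b hab hfa hfb
  have hC := isUniformCorrespondence_pairClass (hhom A hA) (hAr A hA n a) (hAr A hA n b) hfa hfb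
  have hX : typeSet L A b = typeSet L A a :=
    Set.ext fun c => ⟨fun h => hab.trans h, fun h => hab.symm.trans h⟩
  rw [hX] at hC
  exact (hm A hA n a _ _ _ hC).symm

end Unimod
end
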